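/- (Optimality of the converged policy in soft policy iteration) Let Π be a set of policies and let π* ∈ Π satisfy, for every state s ∈ S and every π ∈ Π, Σ_a π*(a|s)·(β·log π*(a|s) − Q^{π*}(s,a)) ≤ Σ_a π(a|s)·(β·log π(a|s) − Q^{π*}(s,a)). Then Q^{π*}(s,a) ≥ Q^π(s,a) for all π ∈ Π and all (s,a) ∈ S × A. -/

import Mathlib

open scoped BigOperators

/-- The soft Bellman operator `T^π` in a finite MDP. -/
noncomputable def softBellman {S A : Type*} [Fintype S] [Fintype A]
    (p : S × A → PMF S) (r : S × A → ℝ) (γ β : ℝ) (pol : S → PMF A)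
    (Q : S × A → ℝ) : S × A → ℝ :=
  fun sa => r sa + γ * ∑ s' : S, ((p sa) s').toReal *
    ∑ a' : A, ((pol s') a').toReal * (Q (s', a') - β * Real.log (((pol s') a').toReal))


theorem pmf_sum_toReal {X : Type*} [Fintype X] (q : PMF X) : ∑ x, (q x).toReal = 1 := by
  rw [← ENNReal.toReal_sum fun a _ => q.apply_ne_top a, ← tsum_fintype (L := .unconditional X),
    q.tsum_coe, ENNReal.toReal_one]

/-- Optimality of the converged policy in soft policy iteration: if `π*` minimizes the
policy-improvement objective against its own soft Q-function among all policies in `Π`,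
then its soft Q-function dominates that of every policy in `Π`. -/
theorem soft_policy_iteration_optimality {S A : Type*} [Fintype S] [Fintype A]
    [Nonempty S] [Nonempty A]
    (p : S × A → PMF S) (r : S × A → ℝ) (γ β : ℝ)
    (hγ0 : 0 ≤ γ) (hγ1 : γ < 1) (hβ : 0 < β)
    (Pi : Set (S → PMF A)) (hPi : ∀ pol ∈ Pi, ∀ s a, 0 < (pol s) a)
    (polStar : S → PMF A) (hpolStar : polStar ∈ Pi)
    (Qstar : S × A → ℝ)
    (hQstar : softBellman p r γ β polStar Qstar = Qstar)
    (hopt : ∀ pol ∈ Pi, ∀ s : S,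
      ∑ a : A, ((polStar s) a).toReal *
          (β * Real.log (((polStar s) a).toReal) - Qstar (s, a)) ≤
      ∑ a : A, ((pol s) a).toReal *
          (β * Real.log (((pol s) a).toReal) - Qstar (s, a))) :
    ∀ pol ∈ Pi, ∀ Qpol : S × A → ℝ,
      softBellman p r γ β pol Qpol = Qpol →
      ∀ sa : S × A, Qpol sa ≤ Qstar sa := by
  intro pol hpol Qpol hQpol
  obtain ⟨x, hx⟩ := Finite.exists_max (fun sa => Qpol sa - Qstar sa)
  set m := Qpol x - Qstar x with hm
  have hV : ∀ s : S,
      ∑ a : A, ((pol s) a).toReal * (Qpol (s, a) - β * Real.log (((pol s) a).toReal)) ≤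
      ∑ a : A, ((polStar s) a).toReal *
        (Qstar (s, a) - β * Real.log (((polStar s) a).toReal)) + m := by
    intro s
    have h1 := hopt pol hpol s
    have h2 : ∑ a : A, ((pol s) a).toReal *
        (Qpol (s, a) - β * Real.log (((pol s) a).toReal)) ≤
        ∑ a : A, (-(((pol s) a).toReal *
          (β * Real.log (((pol s) a).toReal) - Qstar (s, a))) + ((pol s) a).toReal * m) := by
      apply Finset.sum_le_sum
      intro a _
      have h3 := hx (s, a)
      have h4 : 0 ≤ ((pol s) a).toReal := ENNReal.toReal_nonneg
      have h5 := mul_le_mul_of_nonneg_left h3 h4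
      linarith
    rw [Finset.sum_add_distrib, Finset.sum_neg_distrib, ← Finset.sum_mul, pmf_sum_toReal] at h2
    have h6 : ∑ a : A, ((polStar s) a).toReal *
        (Qstar (s, a) - β * Real.log (((polStar s) a).toReal)) =
        -∑ a : A, ((polStar s) a).toReal *
          (β * Real.log (((polStar s) a).toReal) - Qstar (s, a)) := by
      rw [← Finset.sum_neg_distrib]
      exact Finset.sum_congr rfl fun a _ => by ring
    linarith
  have hP := congrFun hQpol x
  have hS := congrFun hQstar x
  simp only [softBellman] at hP hS
  have hW := Finset.sum_le_sum fun (s : S) (_ : s ∈ Finset.univ) =>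
    mul_le_mul_of_nonneg_left (hV s) (ENNReal.toReal_nonneg (a := p x s))
  simp only [mul_add] at hW
  rw [Finset.sum_add_distrib, ← Finset.sum_mul, pmf_sum_toReal] at hW
  have hG := mul_le_mul_of_nonneg_left hW hγ0
  have hm0 : m ≤ 0 := by
    by_contra! h
    nlinarith
  intro sa
  have := hx sa
  linarith
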